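/- Let f ∈ C²(ℝ), let ε_k be a sequence of positive numbers with ε_k → 0, and for each k let u_k : (0,∞) × ℝ → ℝ be of class C² and satisfy −ε_k(∂_tt u_k + ∂_xx u_k) + ∂_t u_k + f'(u_k) ∂_x u_k = 0 pointwise in (0,∞) × ℝ. Assume sup_k ‖u_k‖_{L^∞((0,∞)×ℝ)} < ∞ and u_k → u pointwise almost everywhere in (0,∞) × ℝ. Then u satisfies the entropy inequalities: for every entropy pair (φ, ψ) for f and every nonnegative smooth compactly supported test function w on (0,∞) × ℝ, ∫ [φ(u) ∂_t w + ψ(u) ∂_x w] dt dx ≥ 0. -/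

import Mathlib

open MeasureTheory Filter Topology
open scoped ENNReal NNReal

noncomputable section

/-- `Ω = (0,∞) × ℝ` with coordinates `(t, x)`. -/
def OmgS : Set (ℝ × ℝ) := {q | 0 < q.1}

/-- Partial derivative in the time variable `t`. -/
def pdt (u : ℝ × ℝ → ℝ) : ℝ × ℝ → ℝ := fun q => deriv (fun s => u (s, q.2)) q.1

/-- Partial derivative in the space variable `x`. -/
def pdx (u : ℝ × ℝ → ℝ) : ℝ × ℝ → ℝ := fun q => deriv (fun y => u (q.1, y)) q.2

/-- An entropy pair `(φ, ψ)` for the flux `f`: `φ` is `C²` and convex, `ψ` is `C¹`,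
and `ψ' = φ' f'`. -/
def EntropyPair (f φ ψ : ℝ → ℝ) : Prop :=
  ContDiff ℝ 2 φ ∧ ConvexOn ℝ Set.univ φ ∧ ContDiff ℝ 1 ψ ∧
    ∀ z : ℝ, deriv ψ z = deriv φ z * deriv f z

lemma isOpen_OmgS : IsOpen OmgS := isOpen_lt continuous_const continuous_fst

lemma pdt_eq_fderiv {g : ℝ × ℝ → ℝ} {q : ℝ × ℝ} (hg : DifferentiableAt ℝ g q) :
    pdt g q = fderiv ℝ g q (1, 0) := by
  have h : HasDerivAt (fun s : ℝ => (s, q.2)) ((1 : ℝ), (0 : ℝ)) q.1 :=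
    (hasDerivAt_id q.1).prodMk (hasDerivAt_const q.1 q.2)
  exact (hg.hasFDerivAt.comp_hasDerivAt q.1 h).deriv

lemma pdx_eq_fderiv {g : ℝ × ℝ → ℝ} {q : ℝ × ℝ} (hg : DifferentiableAt ℝ g q) :
    pdx g q = fderiv ℝ g q (0, 1) := by
  have h : HasDerivAt (fun y : ℝ => (q.1, y)) ((0 : ℝ), (1 : ℝ)) q.2 :=
    (hasDerivAt_const q.2 q.1).prodMk (hasDerivAt_id q.2)
  exact (hg.hasFDerivAt.comp_hasDerivAt q.2 h).deriv

lemma pdt_congr {g h : ℝ × ℝ → ℝ} {q : ℝ × ℝ} (hgh : g =ᶠ[𝓝 q] h) : pdt g q = pdt h q := by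
  have hc : Tendsto (fun s : ℝ => (s, q.2)) (𝓝 q.1) (𝓝 q) :=
    Continuous.tendsto (by fun_prop : Continuous fun s : ℝ => (s, q.2)) q.1
  exact EventuallyEq.deriv_eq (hc.eventually hgh)

lemma pdx_congr {g h : ℝ × ℝ → ℝ} {q : ℝ × ℝ} (hgh : g =ᶠ[𝓝 q] h) : pdx g q = pdx h q := by
  have hc : Tendsto (fun y : ℝ => (q.1, y)) (𝓝 q.2) (𝓝 q) :=
    Continuous.tendsto (by fun_prop : Continuous fun y : ℝ => (q.1, y)) q.2
  exact EventuallyEq.deriv_eq (hc.eventually hgh)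

lemma integrable_mul_of_tsupport_subset {E : Type*} [NormedAddCommGroup E]
    [MeasurableSpace E] [BorelSpace E] {μ : Measure E} [IsFiniteMeasureOnCompacts μ] {U : Set E}
    {w g : E → ℝ} (hU : IsOpen U) (hw : Continuous w) (hc : HasCompactSupport w) (hs : tsupport w ⊆ U)
    (hg : ContinuousOn g U) :
    Integrable (fun q => w q * g q) μ := by
  refine Continuous.integrable_of_hasCompactSupport ?_ hc.mul_right
  refine continuous_of_tsupport fun x hx => ?_
  have hxU : x ∈ U := hs (tsupport_mul_subset_left hx)
  exact hw.continuousAt.mul (hg.continuousAt (hU.mem_nhds hxU))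

section DirectionalDerivative

variable {E : Type*} [NormedAddCommGroup E] [NormedSpace ℝ E] {U : Set E}

lemma ContDiffOn.fderiv_apply_of_isOpen {g : E → ℝ} {m n : WithTop ℕ∞} (hg : ContDiffOn ℝ n g U)
    (hU : IsOpen U) (hmn : m + 1 ≤ n) (e : E) : ContDiffOn ℝ m (fun q => fderiv ℝ g q e) U :=
  (hg.fderiv_of_isOpen hU hmn).clm_apply contDiffOn_const

lemma fderiv_comp_real_apply {φ : ℝ → ℝ} {v : E → ℝ} {q : E} (hφ : Differentiable ℝ φ)
    (hv : DifferentiableAt ℝ v q) (e : E) :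
    fderiv ℝ (fun p => φ (v p)) q e = deriv φ (v q) * fderiv ℝ v q e := by
  have h := ((hφ (v q)).hasDerivAt.comp_hasFDerivAt q hv.hasFDerivAt).fderiv
  simpa [Function.comp_def] using congrArg (fun L : E →L[ℝ] ℝ => L e) h

lemma fderiv_fderiv_comp_real_apply {φ : ℝ → ℝ} {v : E → ℝ} (hφ : ContDiff ℝ 2 φ)
    (hU : IsOpen U) (hv : ContDiffOn ℝ 2 v U) {q : E} (hq : q ∈ U) (e : E) :
    fderiv ℝ (fun p => fderiv ℝ (fun p' => φ (v p')) p e) q e =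
      deriv (deriv φ) (v q) * fderiv ℝ v q e ^ 2
        + deriv φ (v q) * fderiv ℝ (fun p => fderiv ℝ v p e) q e := by
  have hvd : ∀ p ∈ U, DifferentiableAt ℝ v p := fun p hp =>
    (hv.differentiableOn (by norm_num)).differentiableAt (hU.mem_nhds hp)
  have hφ1 : Differentiable ℝ φ := hφ.differentiable (by norm_num)
  have hφ' : Differentiable ℝ (deriv φ) :=
    (ContDiff.deriv' (n := 1) (by simpa [one_add_one_eq_two] using hφ)).differentiable (by norm_num)
  have hve : DifferentiableAt ℝ (fun p => fderiv ℝ v p e) q :=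
    ((hv.fderiv_apply_of_isOpen hU (m := 1) (by norm_num [one_add_one_eq_two]) e).differentiableOn
      (by norm_num)).differentiableAt (hU.mem_nhds hq)
  have heq : (fun p => fderiv ℝ (fun p' => φ (v p')) p e) =ᶠ[𝓝 q]
      fun p => deriv φ (v p) * fderiv ℝ v p e := by
    filter_upwards [hU.mem_nhds hq] with p hp
    exact fderiv_comp_real_apply hφ1 (hvd p hp) e
  have hcomp : DifferentiableAt ℝ (fun p => deriv φ (v p)) q :=
    (hφ' (v q)).comp q (hvd q hq)
  rw [heq.fderiv_eq, fderiv_fun_mul hcomp hve]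
  simp only [add_apply, smul_apply, smul_eq_mul]
  rw [fderiv_comp_real_apply hφ' (hvd q hq)]
  ring

variable [MeasurableSpace E] [BorelSpace E] {μ : Measure E}

/-- Integration by parts over an open set containing the support of one of the factors. -/
lemma setIntegral_fderiv_mul_add_mul_fderiv [FiniteDimensional ℝ E] [μ.IsAddHaarMeasure]
    {w g : E → ℝ} (hU : IsOpen U) (hw : ContDiff ℝ 1 w) (hc : HasCompactSupport w)
    (hs : tsupport w ⊆ U) (hg : ContDiffOn ℝ 1 g U) (e : E) :
    Integrable (fun q => fderiv ℝ w q e * g q + w q * fderiv ℝ g q e) (μ.restrict U) ∧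
      ∫ q in U, (fderiv ℝ w q e * g q + w q * fderiv ℝ g q e) ∂μ = 0 := by
  have hw' : Continuous (fun q => fderiv ℝ w q e) :=
    (hw.continuous_fderiv (by norm_num)).clm_apply continuous_const
  have hs' := (tsupport_fderiv_apply_subset ℝ (f := w) e).trans hs
  have i1 : Integrable (fun q => fderiv ℝ w q e * g q) μ :=
    integrable_mul_of_tsupport_subset hU hw' (hc.fderiv_apply ℝ e) hs' hg.continuousOn
  have i2 : Integrable (fun q => w q * fderiv ℝ g q e) μ :=
    integrable_mul_of_tsupport_subset hU hw.continuous hc hs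
      (hg.fderiv_apply_of_isOpen hU (m := 0) (by norm_num) e).continuousOn
  have i3 : Integrable (fun q => w q * g q) μ :=
    integrable_mul_of_tsupport_subset hU hw.continuous hc hs hg.continuousOn
  refine ⟨(i1.add i2).integrableOn, ?_⟩
  rw [setIntegral_eq_integral_of_forall_compl_eq_zero, integral_add i1 i2,
    integral_mul_fderiv_eq_neg_fderiv_mul_of_integrable i1 i2 i3
      (fun x _ => hw.differentiable (by norm_num) x)
      (fun x hx => (hg.differentiableOn (by norm_num)).differentiableAt (hU.mem_nhds (hs hx)))]
  · ring
  · intro x hx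
    rw [image_eq_zero_of_notMem_tsupport fun h => hx (hs h),
      image_eq_zero_of_notMem_tsupport (f := fun q => fderiv ℝ w q e) fun h => hx (hs' h)]
    ring

end DirectionalDerivative

lemma ConvexOn.deriv_deriv_nonneg {φ : ℝ → ℝ} (hφ : ConvexOn ℝ Set.univ φ)
    (hd : Differentiable ℝ φ) (z : ℝ) : 0 ≤ deriv (deriv φ) z :=
  (monotoneOn_univ.1 (hφ.monotoneOn_deriv fun x _ => hd x)).deriv_nonneg

/-- The entropy inequality with viscosity term, for a single viscous approximation. -/
lemma viscous_entropy_integral_nonneg {f φ ψ : ℝ → ℝ} (hφψ : EntropyPair f φ ψ)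
    {ε : ℝ} (hε : 0 ≤ ε) {v : ℝ × ℝ → ℝ} (hv : ContDiffOn ℝ 2 v OmgS)
    (hpde : ∀ q ∈ OmgS,
      -ε * (pdt (pdt v) q + pdx (pdx v) q) + pdt v q + deriv f (v q) * pdx v q = 0)
    {w : ℝ × ℝ → ℝ} (hw : ContDiff ℝ 2 w) (hc : HasCompactSupport w)
    (hs : tsupport w ⊆ OmgS) (hw0 : ∀ q, 0 ≤ w q) :
    0 ≤ ∫ q in OmgS, (φ (v q) * fderiv ℝ w q (1, 0) + ψ (v q) * fderiv ℝ w q (0, 1)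
      + ε * (φ (v q) * (fderiv ℝ (fun p => fderiv ℝ w p (1, 0)) q (1, 0)
        + fderiv ℝ (fun p => fderiv ℝ w p (0, 1)) q (0, 1)))) := by
  obtain ⟨hφ, hconv, hψ, hpair⟩ := hφψ
  have hU := isOpen_OmgS
  have hφd : Differentiable ℝ φ := hφ.differentiable (by norm_num)
  have hψd : Differentiable ℝ ψ := hψ.differentiable (by norm_num)
  have hvd : ∀ p ∈ OmgS, DifferentiableAt ℝ v p := fun p hp =>
    (hv.differentiableOn (by norm_num)).differentiableAt (hU.mem_nhds hp)
  have hΦ : ContDiffOn ℝ 2 (fun q => φ (v q)) OmgS := hφ.comp_contDiffOn hv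
  have hΨ : ContDiffOn ℝ 1 (fun q => ψ (v q)) OmgS :=
    hψ.comp_contDiffOn (hv.of_le (by norm_num))
  have h12 : (1 : WithTop ℕ∞) + 1 ≤ 2 := by norm_num [one_add_one_eq_two]
  have hw1 : ContDiff ℝ 1 w := hw.of_le (by norm_num)
  have hΦ1 : ContDiffOn ℝ 1 (fun q => φ (v q)) OmgS := hΦ.of_le (by norm_num)
  have hwe (e : ℝ × ℝ) : ContDiff ℝ 1 (fun q => fderiv ℝ w q e) :=
    (hw.fderiv_right h12).clm_apply contDiff_const
  have hse (e : ℝ × ℝ) := (tsupport_fderiv_apply_subset ℝ (f := w) e).trans hs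
  have ibp_w {g : ℝ × ℝ → ℝ} (hg : ContDiffOn ℝ 1 g OmgS) (e : ℝ × ℝ) :=
    setIntegral_fderiv_mul_add_mul_fderiv (μ := volume) hU hw1 hc hs hg e
  have ibp_dw (e : ℝ × ℝ) := setIntegral_fderiv_mul_add_mul_fderiv (μ := volume) hU (hwe e)
    (hc.fderiv_apply ℝ e) (hse e) hΦ1 e
  have hΦe (e : ℝ × ℝ) := hΦ.fderiv_apply_of_isOpen hU h12 e
  obtain ⟨a1, b1⟩ := ibp_w hΦ1 (1, 0)
  obtain ⟨a2, b2⟩ := ibp_w hΨ (0, 1)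
  obtain ⟨a3, b3⟩ := ibp_w (hΦe (1, 0)) (1, 0)
  obtain ⟨a4, b4⟩ := ibp_w (hΦe (0, 1)) (0, 1)
  obtain ⟨a5, b5⟩ := ibp_dw (1, 0)
  obtain ⟨a6, b6⟩ := ibp_dw (0, 1)
  have hZ := (a1.add a2).add (((a5.sub a3).add (a6.sub a4)).const_mul ε)
  have hZ0 := integral_add (a1.add a2) (((a5.sub a3).add (a6.sub a4)).const_mul ε)
  rw [integral_add' a1 a2, integral_const_mul, integral_add' (a5.sub a3) (a6.sub a4),
    integral_sub' a5 a3, integral_sub' a6 a4, b1, b2, b3, b4, b5, b6] at hZ0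
  by_cases hI : Integrable (fun q => φ (v q) * fderiv ℝ w q (1, 0) + ψ (v q) * fderiv ℝ w q (0, 1)
      + ε * (φ (v q) * (fderiv ℝ (fun p => fderiv ℝ w p (1, 0)) q (1, 0)
        + fderiv ℝ (fun p => fderiv ℝ w p (0, 1)) q (0, 1)))) (volume.restrict OmgS)
  swap
  · rw [integral_undef hI]
  refine le_trans (le_of_eq (by simpa using hZ0.symm))
    (setIntegral_mono_on hZ hI hU.measurableSet fun q hq => ?_)
  have hve (e : ℝ × ℝ) : DifferentiableAt ℝ (fun p => fderiv ℝ v p e) q :=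
    ((hv.fderiv_apply_of_isOpen hU h12 e).differentiableOn
      (by norm_num)).differentiableAt (hU.mem_nhds hq)
  have hp := hpde q hq
  have ett : pdt (pdt v) q = fderiv ℝ (fun p => fderiv ℝ v p (1, 0)) q (1, 0) := by
    rw [← pdt_eq_fderiv (hve _)]
    refine pdt_congr ?_
    filter_upwards [hU.mem_nhds hq] with p hp using pdt_eq_fderiv (hvd p hp)
  have exx : pdx (pdx v) q = fderiv ℝ (fun p => fderiv ℝ v p (0, 1)) q (0, 1) := by
    rw [← pdx_eq_fderiv (hve _)]
    refine pdx_congr ?_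
    filter_upwards [hU.mem_nhds hq] with p hp using pdx_eq_fderiv (hvd p hp)
  rw [ett, exx, pdt_eq_fderiv (hvd q hq), pdx_eq_fderiv (hvd q hq)] at hp
  simp only [Pi.add_apply, Pi.sub_apply]
  rw [fderiv_fderiv_comp_real_apply hφ hU hv hq, fderiv_fderiv_comp_real_apply hφ hU hv hq,
    fderiv_comp_real_apply hφd (hvd q hq), fderiv_comp_real_apply hφd (hvd q hq),
    fderiv_comp_real_apply hψd (hvd q hq), hpair]
  have hR : 0 ≤ ε * deriv (deriv φ) (v q)
      * (fderiv ℝ v q (1, 0) ^ 2 + fderiv ℝ v q (0, 1) ^ 2) * w q :=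
    mul_nonneg (mul_nonneg (mul_nonneg hε (hconv.deriv_deriv_nonneg hφd _)) (by positivity))
      (hw0 q)
  linear_combination hR + w q * deriv φ (v q) * hp

/-- Vanishing viscosity limit: if `ε_k → 0`, `u_k` are uniformly bounded `C²`
solutions of `−ε_k(∂_tt u_k + ∂_xx u_k) + ∂_t u_k + f'(u_k) ∂_x u_k = 0` on `(0,∞) × ℝ`
converging pointwise a.e. to `u`, then `u` satisfies the entropy inequalities:
`∫ [φ(u) ∂_t w + ψ(u) ∂_x w] ≥ 0` for every entropy pair `(φ, ψ)` and every nonnegative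
smooth compactly supported test function `w`. -/
theorem vanishing_viscosity_entropy (f : ℝ → ℝ) (hf : ContDiff ℝ 2 f)
    (εk : ℕ → ℝ) (hεpos : ∀ k, 0 < εk k) (hε0 : Tendsto εk atTop (𝓝 0))
    (uk : ℕ → ℝ × ℝ → ℝ) (hukC2 : ∀ k, ContDiffOn ℝ 2 (uk k) OmgS)
    (hpde : ∀ k, ∀ q ∈ OmgS,
      -(εk k) * (pdt (pdt (uk k)) q + pdx (pdx (uk k)) q)
        + pdt (uk k) q + deriv f (uk k q) * pdx (uk k) q = 0)
    (M : ℝ) (hM : ∀ k, ∀ q ∈ OmgS, |uk k q| ≤ M)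
    (u : ℝ × ℝ → ℝ)
    (hconv : ∀ᵐ q ∂(volume.restrict OmgS), Tendsto (fun k => uk k q) atTop (𝓝 (u q))) :
    ∀ φ ψ : ℝ → ℝ, EntropyPair f φ ψ →
      ∀ w : ℝ × ℝ → ℝ, ContDiff ℝ (⊤ : ℕ∞) w → HasCompactSupport w →
        tsupport w ⊆ OmgS → (∀ q, 0 ≤ w q) →
        0 ≤ ∫ q in OmgS, (φ (u q) * pdt w q + ψ (u q) * pdx w q) := by
  intro φ ψ hφψ w hw hc hs hw0
  have hw2 : ContDiff ℝ 2 w := contDiff_infty.1 hw 2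
  have hwd : Differentiable ℝ w := hw2.differentiable (by norm_num)
  have hφc : Continuous φ := hφψ.1.continuous
  have hψc : Continuous ψ := hφψ.2.2.1.continuous
  have hcont1 (e : ℝ × ℝ) : ContDiff ℝ 1 (fun q => fderiv ℝ w q e) :=
    (hw2.fderiv_right (by norm_num [one_add_one_eq_two])).clm_apply contDiff_const
  have hcont2 (e : ℝ × ℝ) : Continuous (fun q => fderiv ℝ (fun p => fderiv ℝ w p e) q e) :=
    ((hcont1 e).continuous_fderiv (by norm_num)).clm_apply continuous_const
  have hint1 (e : ℝ × ℝ) : Integrable (fun q => fderiv ℝ w q e) (volume.restrict OmgS) :=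
    ((hcont1 e).continuous.integrable_of_hasCompactSupport (hc.fderiv_apply ℝ e)).integrableOn
  have hint2 (e : ℝ × ℝ) : Integrable (fun q => fderiv ℝ (fun p => fderiv ℝ w p e) q e)
      (volume.restrict OmgS) :=
    ((hcont2 e).integrable_of_hasCompactSupport
      ((hc.fderiv_apply ℝ e).fderiv_apply ℝ e)).integrableOn
  obtain ⟨A, hA⟩ := (isCompact_Icc (a := -M) (b := M)).exists_bound_of_continuousOn hφc.continuousOn
  obtain ⟨B, hB⟩ := (isCompact_Icc (a := -M) (b := M)).exists_bound_of_continuousOn hψc.continuousOn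
  obtain ⟨C, hC⟩ := hε0.norm.bddAbove_range
  have hC' (k : ℕ) : ‖εk k‖ ≤ C := hC ⟨k, rfl⟩
  simp_rw [pdt_eq_fderiv (hwd _), pdx_eq_fderiv (hwd _)]
  refine ge_of_tendsto' (tendsto_integral_of_dominated_convergence
    (fun q => A * ‖fderiv ℝ w q (1, 0)‖ + B * ‖fderiv ℝ w q (0, 1)‖
      + C * (A * ‖fderiv ℝ (fun p => fderiv ℝ w p (1, 0)) q (1, 0)
        + fderiv ℝ (fun p => fderiv ℝ w p (0, 1)) q (0, 1)‖)) (fun k => ?_) ?_ (fun k => ?_) ?_)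
    fun k => viscous_entropy_integral_nonneg hφψ (hεpos k).le (hukC2 k) (hpde k) hw2 hc hs hw0
  · have hu := (hukC2 k).continuousOn
    have h1 := hφc.comp_continuousOn hu
    have h2 := hψc.comp_continuousOn hu
    refine ContinuousOn.aestronglyMeasurable ?_ isOpen_OmgS.measurableSet
    exact ((h1.mul (hcont1 _).continuous.continuousOn).add
      (h2.mul (hcont1 _).continuous.continuousOn)).add (continuousOn_const.mul
        (h1.mul ((hcont2 _).add (hcont2 _)).continuousOn))
  · exact (((hint1 _).norm.const_mul A).add ((hint1 _).norm.const_mul B)).add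
      ((((hint2 _).add (hint2 _)).norm.const_mul A).const_mul C)
  · filter_upwards [ae_restrict_mem isOpen_OmgS.measurableSet] with q hq
    have hmem : uk k q ∈ Set.Icc (-M) M := abs_le.1 (hM k q hq)
    refine (norm_add₃_le).trans ?_
    simp only [norm_mul]
    have hC0 : 0 ≤ C := (norm_nonneg _).trans (hC' k)
    gcongr
    · exact hA _ hmem
    · exact hB _ hmem
    · exact hC' k
    · exact hA _ hmem
  · filter_upwards [hconv] with q hq
    have h1 := (hφc.tendsto (u q)).comp hq
    have h2 := (hψc.tendsto (u q)).comp hq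
    simpa using ((h1.mul_const _).add (h2.mul_const _)).add (hε0.mul (h1.mul_const _))
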